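/- arXiv:1204.6008 — 2 statements merged into one kernel-verified Lean document; each statement's English description precedes it below -/
import Mathlib

section
/- Let d ≥ 1, p ∈ [1,∞), and let φ : ℝ^d → ℝ^d be a bi-Lipschitz homeomorphism preserving Lebesgue measure. There is a constant C depending only on d and p such that for every ball B = B(x₀, r_B) in ℝ^d there exists a countable collection of balls (O_k)_k with: (i) the doubled balls (2O_k)_k cover φ(B) and each point of ℝ^d lies in at most C of the balls 2O_k; (ii) the balls O_k are pairwise disjoint and contained in φ(B); (iii) writing r_{O_k} for the radius of O_k, one has r_{O_k} ≤ r_B for all k and (1/|B|) Σ_k |O_k| · (log(r_B / r_{O_k}))^p ≤ C · (log K(φ))^p. -/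
open Metric MeasureTheory Set

/-- `K(φ)`: the supremum over pairs of distinct points of
`|φ(x) − φ(y)|/|x − y| + |x − y|/|φ(x) − φ(y)|`. -/
noncomputable def Kconst {d : ℕ} (φ : EuclideanSpace ℝ (Fin d) → EuclideanSpace ℝ (Fin d)) : ℝ :=
  ⨆ q : {p : EuclideanSpace ℝ (Fin d) × EuclideanSpace ℝ (Fin d) // p.1 ≠ p.2},
    dist (φ q.1.1) (φ q.1.2) / dist q.1.1 q.1.2 +
      dist q.1.1 q.1.2 / dist (φ q.1.1) (φ q.1.2)

/-- Volume of a Euclidean ball, as a real number. -/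
lemma aux_vol {d : ℕ} (hd : 1 ≤ d) (x : EuclideanSpace ℝ (Fin d)) {r : ℝ} (hr : 0 ≤ r) :
    volume.real (ball x r) = r ^ d * volume.real (ball (0 : EuclideanSpace ℝ (Fin d)) 1) := by
  have : Nonempty (Fin d) := ⟨⟨0, hd⟩⟩
  rw [measureReal_def, Measure.addHaar_ball volume x hr, ENNReal.toReal_mul,
    ENNReal.toReal_ofReal (by positivity), measureReal_def]
  simp

lemma aux_vol_pos {d : ℕ} (x : EuclideanSpace ℝ (Fin d)) {r : ℝ} (hr : 0 < r) :
    0 < volume.real (ball x r) := by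
  rw [measureReal_def]
  exact ENNReal.toReal_pos (measure_ball_pos _ _ hr).ne' measure_ball_lt_top.ne

lemma aux_K {d : ℕ} (hd : 1 ≤ d) (φ : EuclideanSpace ℝ (Fin d) → EuclideanSpace ℝ (Fin d))
    (hb : Function.Bijective φ) (h1 : ∃ A : NNReal, LipschitzWith A φ)
    (h2 : ∃ A : NNReal, LipschitzWith A (Function.invFun φ)) :
    2 ≤ Kconst φ ∧ ∀ x y, dist x y ≤ Kconst φ * dist (φ x) (φ y) := by
  have : Nonempty (Fin d) := ⟨⟨0, hd⟩⟩
  obtain ⟨A, hA⟩ := h1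
  obtain ⟨A', hA'⟩ := h2
  have hinv : ∀ x, Function.invFun φ (φ x) = x := Function.leftInverse_invFun hb.1
  have hbdd : BddAbove (range fun q : {p : EuclideanSpace ℝ (Fin d) × EuclideanSpace ℝ (Fin d) //
      p.1 ≠ p.2} => dist (φ q.1.1) (φ q.1.2) / dist q.1.1 q.1.2 +
      dist q.1.1 q.1.2 / dist (φ q.1.1) (φ q.1.2)) := by
    refine ⟨A + A', ?_⟩
    rintro _ ⟨⟨⟨x, y⟩, hxy⟩, rfl⟩
    have hp : 0 < dist x y := dist_pos.2 hxy
    have hp' : 0 < dist (φ x) (φ y) := dist_pos.2 (hb.1.ne hxy)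
    refine add_le_add ?_ ?_
    · exact (div_le_iff₀ hp).2 (hA.dist_le_mul x y)
    · refine (div_le_iff₀ hp').2 ?_
      have := hA'.dist_le_mul (φ x) (φ y)
      rwa [hinv, hinv] at this
  have key : ∀ x y, x ≠ y → dist (φ x) (φ y) / dist x y + dist x y / dist (φ x) (φ y)
      ≤ Kconst φ := fun x y hxy => le_ciSup hbdd ⟨(x, y), hxy⟩
  constructor
  · obtain ⟨x, y, hxy⟩ := exists_pair_ne (EuclideanSpace ℝ (Fin d))
    refine le_trans ?_ (key x y hxy)
    have hp : 0 < dist x y := dist_pos.2 hxy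
    have hp' : 0 < dist (φ x) (φ y) := dist_pos.2 (hb.1.ne hxy)
    rw [div_add_div _ _ hp.ne' hp'.ne', le_div_iff₀ (by positivity)]
    nlinarith [sq_nonneg (dist x y - dist (φ x) (φ y))]
  · intro x y
    by_cases hxy : x = y
    · simp [hxy]
    have hp : 0 < dist x y := dist_pos.2 hxy
    have hp' : 0 < dist (φ x) (φ y) := dist_pos.2 (hb.1.ne hxy)
    rw [← div_le_iff₀ hp']
    refine le_trans ?_ (key x y hxy)
    have : 0 < dist (φ x) (φ y) / dist x y := by positivity
    linarith

/-- Whitney-type decomposition with dyadic radii. -/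
lemma aux_whitney {d : ℕ} (Ω : Set (EuclideanSpace ℝ (Fin d))) (hΩ : IsOpen Ω)
    (hne : Ω.Nonempty) (hc : Ωᶜ.Nonempty) (R : ℝ) (hR : 0 < R)
    (hD : ∀ x ∈ Ω, infDist x Ωᶜ ≤ R) :
    ∃ (c : ℕ → EuclideanSpace ℝ (Fin d)) (n : ℕ → ℕ),
      (∀ k, 4 * (R * (1 / 2) ^ n k) < infDist (c k) Ωᶜ) ∧
      (∀ k, infDist (c k) Ωᶜ ≤ 8 * (R * (1 / 2) ^ n k)) ∧
      (Pairwise fun i j => Disjoint (ball (c i) (R * (1 / 2) ^ n i))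
        (ball (c j) (R * (1 / 2) ^ n j))) ∧
      Ω ⊆ ⋃ k, ball (c k) (2 * (R * (1 / 2) ^ n k)) := by
  have hpos : ∀ x ∈ Ω, 0 < infDist x Ωᶜ := fun x hx =>
    (hΩ.isClosed_compl.notMem_iff_infDist_pos hc).1 (by simpa using hx)
  have hn : ∀ x, ∃ n : ℕ, x ∈ Ω → 4 * (R * (1 / 2) ^ n) < infDist x Ωᶜ ∧
      infDist x Ωᶜ ≤ 8 * (R * (1 / 2) ^ n) := by
    intro x
    by_cases hx : x ∈ Ω
    · have h0 := hpos x hx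
      have h1 := hD x hx
      obtain ⟨n, hn1, hn2⟩ := exists_nat_pow_near_of_lt_one (x := infDist x Ωᶜ / (4 * R))
        (y := (1 / 2 : ℝ)) (by positivity) (by rw [div_le_one (by positivity)]; linarith)
        (by norm_num) (by norm_num)
      rw [lt_div_iff₀ (by positivity)] at hn1
      rw [div_le_iff₀ (by positivity)] at hn2
      refine ⟨n + 1, fun _ => ⟨by linarith, ?_⟩⟩
      rw [pow_succ]; linarith
    · exact ⟨0, fun h => absurd h hx⟩
  choose n hn using hn
  have hr : ∀ x, 0 < R * (1 / 2 : ℝ) ^ n x := fun x => by positivity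
  obtain ⟨u, huΩ, hud, hu⟩ := Vitali.exists_disjoint_subfamily_covering_enlargement
    (fun x => ball x (R * (1 / 2) ^ n x)) Ω (fun x => R * (1 / 2) ^ n x) (3 / 2) (by norm_num)
    (fun x _ => (hr x).le) R
    (fun x _ => mul_le_of_le_one_right hR.le (pow_le_one₀ (by norm_num) (by norm_num)))
    (fun x _ => ⟨x, mem_ball_self (hr x)⟩)
  have hcov : ∀ x ∈ Ω, ∃ b ∈ u, x ∈ ball b (2 * (R * (1 / 2) ^ n b)) := by
    intro x hx
    obtain ⟨b, hb, ⟨z, hz1, hz2⟩, hle⟩ := hu x hx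
    refine ⟨b, hb, ?_⟩
    have hle' : R * (1 / 2 : ℝ) ^ n x ≤ R * (1 / 2) ^ n b := by
      refine mul_le_mul_of_nonneg_left ?_ hR.le
      refine pow_le_pow_of_le_one (by norm_num) (by norm_num) ?_
      by_contra! hlt
      have h3 : (1 / 2 : ℝ) ^ n b ≤ (1 / 2) ^ (n x + 1) :=
        pow_le_pow_of_le_one (by norm_num) (by norm_num) hlt
      have h4 : (1 / 2 : ℝ) ^ n x ≤ 3 / 2 * (1 / 2) ^ n b := by
        have : R * (1 / 2 : ℝ) ^ n x ≤ R * (3 / 2 * (1 / 2) ^ n b) := by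
          linarith
        exact le_of_mul_le_mul_left this hR
      have h5 : 0 < (1 / 2 : ℝ) ^ n x := by positivity
      rw [pow_succ] at h3
      linarith
    rw [mem_ball] at hz1 hz2 ⊢
    have := dist_triangle x z b
    rw [dist_comm x z] at this
    linarith
  have hcount : u.Countable := hud.countable_of_isOpen (fun _ _ => isOpen_ball)
    (fun x _ => ⟨x, mem_ball_self (hr x)⟩)
  have hinf : u.Infinite := by
    intro hfin
    -- a point of the frontier
    obtain ⟨z, hz⟩ : (frontier Ω).Nonempty := by
      rw [nonempty_frontier_iff]
      exact ⟨hne, fun h => by simp [h] at hc⟩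
    have hzc : z ∈ Ωᶜ := by
      have := hz.2
      rwa [hΩ.interior_eq] at this
    have hune : u.Nonempty := by
      obtain ⟨x, hx⟩ := hne
      obtain ⟨b, hb, _⟩ := hcov x hx
      exact ⟨b, hb⟩
    obtain ⟨b0, hb0, hmin⟩ := hfin.exists_minimalFor (fun x => R * (1 / 2 : ℝ) ^ n x) u hune
    have hmin' : ∀ b ∈ u, R * (1 / 2 : ℝ) ^ n b0 ≤ R * (1 / 2 : ℝ) ^ n b := by
      intro b hb
      rcases le_total (R * (1 / 2 : ℝ) ^ n b0) (R * (1 / 2 : ℝ) ^ n b) with h | h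
      · exact h
      · exact hmin hb h
    obtain ⟨x, hx, hxz⟩ := Metric.mem_closure_iff.1 hz.1 _ (hr b0)
    obtain ⟨b, hb, hxb⟩ := hcov x hx
    have h1 := (hn b (huΩ hb)).1
    have h2 : infDist b Ωᶜ ≤ dist b z := infDist_le_dist_of_mem hzc
    have h3 := dist_triangle b x z
    rw [mem_ball, dist_comm] at hxb
    rw [dist_comm] at hxz
    have := hmin' b hb
    have := hr b
    linarith
  have := hcount.to_subtype
  have := hinf.to_subtype
  obtain ⟨e⟩ : Nonempty (ℕ ≃ u) := nonempty_equiv_of_countable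
  refine ⟨fun k => e k, fun k => n (e k), fun k => (hn _ (huΩ (e k).2)).1,
    fun k => (hn _ (huΩ (e k).2)).2, ?_, ?_⟩
  · intro i j hij
    exact hud (e i).2 (e j).2 (fun h => hij (e.injective (Subtype.ext h)))
  · intro x hx
    obtain ⟨b, hb, hxb⟩ := hcov x hx
    refine mem_iUnion.2 ⟨e.symm ⟨b, hb⟩, ?_⟩
    simpa using hxb

/-- Bounded overlap. -/
lemma aux_overlap {d : ℕ} (hd : 1 ≤ d) (Ω : Set (EuclideanSpace ℝ (Fin d)))
    (c : ℕ → EuclideanSpace ℝ (Fin d)) (ρ : ℕ → ℝ) (hρ : ∀ k, 0 < ρ k)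
    (h4 : ∀ k, 4 * ρ k < infDist (c k) Ωᶜ) (h8 : ∀ k, infDist (c k) Ωᶜ ≤ 8 * ρ k)
    (hdis : Pairwise fun i j => Disjoint (ball (c i) (ρ i)) (ball (c j) (ρ j)))
    (y : EuclideanSpace ℝ (Fin d)) :
    {k | y ∈ ball (c k) (2 * ρ k)}.encard ≤ (15 ^ d : ℕ) := by
  by_contra! hlt
  have hlt' : ((15 ^ d + 1 : ℕ) : ℕ∞) ≤ {k | y ∈ ball (c k) (2 * ρ k)}.encard := by
    rw [Nat.cast_add, Nat.cast_one]
    exact Order.add_one_le_of_lt hlt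
  obtain ⟨t, hts, htc⟩ := exists_subset_encard_eq hlt'
  have htf : t.Finite := finite_of_encard_eq_coe htc
  lift t to Finset ℕ using htf
  rw [encard_coe_eq_coe_finsetCard] at htc
  have htc' : t.card = 15 ^ d + 1 := by exact_mod_cast htc
  set D := infDist y Ωᶜ with hDdef
  have hb : ∀ k ∈ t, D / 10 ≤ ρ k ∧ ρ k ≤ D / 2 ∧ dist y (c k) < 2 * ρ k := by
    intro k hk
    have hk' : dist y (c k) < 2 * ρ k := hts hk
    have h1 : infDist y Ωᶜ ≤ infDist (c k) Ωᶜ + dist y (c k) := infDist_le_infDist_add_dist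
    have h2 : infDist (c k) Ωᶜ ≤ infDist y Ωᶜ + dist (c k) y := infDist_le_infDist_add_dist
    rw [dist_comm] at h2
    have := h4 k
    have := h8 k
    refine ⟨by linarith, by linarith, hk'⟩
  have hDpos : 0 < D := by
    have : t.Nonempty := by rw [← Finset.card_pos, htc']; positivity
    obtain ⟨k, hk⟩ := this
    have := (hb k hk).2.1
    have := hρ k
    linarith
  have hsub : (⋃ k ∈ t, ball (c k) (ρ k)) ⊆ ball y (3 / 2 * D) := by
    refine iUnion₂_subset fun k hk z hz => ?_
    obtain ⟨_, h2, h3⟩ := hb k hk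
    rw [mem_ball] at hz ⊢
    have := dist_triangle z (c k) y
    rw [dist_comm (c k)] at this
    linarith
  have hvol := measureReal_mono (μ := volume) hsub measure_ball_lt_top.ne
  rw [measureReal_biUnion_finset (fun i _ j _ hij => hdis hij) (fun _ _ => measurableSet_ball)
    (fun _ _ => measure_ball_lt_top.ne)] at hvol
  have hV := aux_vol_pos (0 : EuclideanSpace ℝ (Fin d)) one_pos
  have hlow : (t.card : ℝ) * ((D / 10) ^ d * volume.real (ball (0 : EuclideanSpace ℝ (Fin d)) 1))
      ≤ ∑ k ∈ t, volume.real (ball (c k) (ρ k)) := by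
    rw [← nsmul_eq_mul]
    refine Finset.card_nsmul_le_sum _ _ _ fun k hk => ?_
    rw [aux_vol hd _ (hρ k).le]
    have := (hb k hk).1
    gcongr
  rw [aux_vol hd y (by positivity : (0 : ℝ) ≤ 3 / 2 * D)] at hvol
  have h15 : (3 / 2 * D) ^ d = 15 ^ d * (D / 10) ^ d := by
    rw [← mul_pow]; congr 1; ring
  rw [h15, mul_assoc] at hvol
  have := le_of_mul_le_mul_right (hlow.trans hvol) (by positivity)
  rw [htc'] at this
  push_cast at this
  linarith

/-- Volume of a spherical shell. -/
lemma aux_shell {d : ℕ} (hd : 1 ≤ d) (x₀ : EuclideanSpace ℝ (Fin d)) {R t : ℝ} (hR : 0 < R)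
    (ht : 0 ≤ t) :
    volume.real (ball x₀ R \ ball x₀ (R * (1 - t))) ≤ d * t * volume.real (ball x₀ R) := by
  have hB := aux_vol_pos x₀ hR
  have hd' : (1 : ℝ) ≤ d := by exact_mod_cast hd
  rcases le_total 1 t with h | h
  · refine (measureReal_mono sdiff_subset measure_ball_lt_top.ne).trans ?_
    nlinarith [mul_le_mul hd' h zero_le_one (by positivity)]
  · have hsub : ball x₀ (R * (1 - t)) ⊆ ball x₀ R := ball_subset_ball (by nlinarith)
    rw [measureReal_sdiff hsub measurableSet_ball measure_ball_lt_top.ne,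
      aux_vol hd x₀ hR.le, aux_vol hd x₀ (mul_nonneg hR.le (by linarith)), mul_pow]
    have hber := one_add_mul_le_pow (a := -t) (by linarith) d
    have hV := aux_vol_pos (0 : EuclideanSpace ℝ (Fin d)) one_pos
    have hRV : 0 < R ^ d * volume.real (ball (0 : EuclideanSpace ℝ (Fin d)) 1) := by positivity
    rw [← sub_eq_add_neg] at hber
    nlinarith [mul_le_mul_of_nonneg_left hber hRV.le]

lemma aux_summable (p : ℝ) : Summable fun j : ℕ => (1 + j : ℝ) ^ p * (1 / 2 : ℝ) ^ j := by
  have h := summable_pow_mul_geometric_of_norm_lt_one (R := ℝ) ⌈p⌉₊ (r := 1 / 2) (by norm_num)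
  have h' := ((summable_nat_add_iff 1).2 h).mul_left 2
  refine Summable.of_nonneg_of_le (fun j => by positivity) (fun j => ?_) h'
  have h1 : (1 + j : ℝ) ^ p ≤ (1 + j : ℝ) ^ ⌈p⌉₊ := by
    rw [← Real.rpow_natCast]
    exact Real.rpow_le_rpow_of_exponent_le (by simp) (Nat.le_ceil p)
  have h2 : 0 < (1 / 2 : ℝ) ^ j := by positivity
  have h3 := mul_le_mul_of_nonneg_right h1 h2.le
  rw [pow_succ]
  push_cast
  rw [add_comm (j : ℝ) 1]
  linarith

theorem stmt6 (d : ℕ) (hd : 1 ≤ d) (p : ℝ) (hp : 1 ≤ p) :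
    ∃ C : ℕ, 0 < C ∧
      ∀ (φ : EuclideanSpace ℝ (Fin d) → EuclideanSpace ℝ (Fin d)),
        Function.Bijective φ →
        (∃ A : NNReal, LipschitzWith A φ) →
        (∃ A : NNReal, LipschitzWith A (Function.invFun φ)) →
        MeasurePreserving φ volume volume →
        ∀ (x₀ : EuclideanSpace ℝ (Fin d)) (rB : ℝ), 0 < rB →
          ∃ (c : ℕ → EuclideanSpace ℝ (Fin d)) (ρ : ℕ → ℝ),
            (∀ k, 0 < ρ k) ∧
            -- (i) the doubled balls cover φ(B) with bounded overlap
            (φ '' ball x₀ rB ⊆ ⋃ k, ball (c k) (2 * ρ k)) ∧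
            (∀ y : EuclideanSpace ℝ (Fin d), {k | y ∈ ball (c k) (2 * ρ k)}.encard ≤ C) ∧
            -- (ii) the balls are pairwise disjoint and contained in φ(B)
            (Pairwise fun i j => Disjoint (ball (c i) (ρ i)) (ball (c j) (ρ j))) ∧
            (∀ k, ball (c k) (ρ k) ⊆ φ '' ball x₀ rB) ∧
            -- (iii) radii are at most r_B and the weighted sum estimate holds
            (∀ k, ρ k ≤ rB) ∧
            (1 / (volume (ball x₀ rB)).toReal) *
                ∑' k, (volume (ball (c k) (ρ k))).toReal * Real.log (rB / ρ k) ^ p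
              ≤ C * Real.log (Kconst φ) ^ p := by
  have : Nonempty (Fin d) := ⟨⟨0, hd⟩⟩
  set S : ℝ := ∑' j : ℕ, (1 + j : ℝ) ^ p * (1 / 2 : ℝ) ^ j with hS
  refine ⟨15 ^ d + ⌈d * 18 * S⌉₊, by positivity, ?_⟩
  intro φ hb h1 h2 hmp x₀ R hR
  obtain ⟨hK2, hK⟩ := aux_K hd φ hb h1 h2
  set K := Kconst φ with hKdef
  set Ω := φ '' ball x₀ R with hΩdef
  have hpre : φ ⁻¹' Ω = ball x₀ R := preimage_image_eq _ hb.1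
  have hΩo : IsOpen Ω := by
    obtain ⟨A', hA'⟩ := h2
    have : Ω = Function.invFun φ ⁻¹' ball x₀ R := by
      rw [hΩdef, image_eq_preimage_of_inverse (Function.leftInverse_invFun hb.1)
        (Function.rightInverse_invFun hb.2)]
    rw [this]
    exact isOpen_ball.preimage hA'.continuous
  have hΩne : Ω.Nonempty := ⟨φ x₀, mem_image_of_mem _ (mem_ball_self hR)⟩
  have hΩvol : volume Ω = volume (ball x₀ R) := by
    rw [← hmp.measure_preimage hΩo.measurableSet.nullMeasurableSet, hpre]
  have hΩc : Ωᶜ.Nonempty := by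
    rw [nonempty_compl]
    intro h
    have : volume Ω = ⊤ := by rw [h]; exact measure_univ_of_isAddLeftInvariant _
    rw [hΩvol] at this
    exact measure_ball_lt_top.ne this
  have hballΩ : ∀ x s, s ≤ infDist x Ωᶜ → ball x s ⊆ Ω := by
    intro x s hs y hy
    by_contra hyc
    have : infDist x Ωᶜ ≤ dist x y := infDist_le_dist_of_mem hyc
    rw [mem_ball, dist_comm] at hy
    linarith
  have hD : ∀ x ∈ Ω, infDist x Ωᶜ ≤ R := by
    intro x _
    by_contra! hlt
    have h := measure_mono (μ := volume) (hballΩ x _ le_rfl)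
    rw [hΩvol] at h
    have h' := ENNReal.toReal_mono measure_ball_lt_top.ne h
    rw [← measureReal_def, ← measureReal_def, aux_vol hd _ infDist_nonneg,
      aux_vol hd _ hR.le] at h'
    have h'' := le_of_mul_le_mul_right h' (aux_vol_pos _ one_pos)
    have := pow_lt_pow_left₀ hlt hR.le (by omega : d ≠ 0)
    linarith
  obtain ⟨c, n, h4, h8, hdis, hcov⟩ := aux_whitney Ω hΩo hΩne hΩc R hR hD
  have hρ : ∀ k, 0 < R * (1 / 2 : ℝ) ^ n k := fun k => by positivity
  have hsubΩ : ∀ k, ball (c k) (R * (1 / 2) ^ n k) ⊆ Ω := fun k =>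
    hballΩ _ _ (by linarith [h4 k, hρ k])
  refine ⟨c, fun k => R * (1 / 2) ^ n k, hρ, hcov, ?_, hdis, hsubΩ, ?_, ?_⟩
  · intro y
    refine (aux_overlap hd Ω c _ hρ h4 h8 hdis y).trans ?_
    exact_mod_cast Nat.le_add_right _ _
  · intro k
    exact mul_le_of_le_one_right hR.le (pow_le_one₀ (by norm_num) (by norm_num))
  -- the sum estimate
  have hB := aux_vol_pos x₀ hR
  have hlogK : 0 < Real.log K := Real.log_pos (by linarith)
  have hlog2 : 0 < Real.log 2 := Real.log_pos (by norm_num)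
  obtain ⟨N, hN1, hN2⟩ := exists_nat_pow_near (x := K) (y := 2) (by linarith) (by norm_num)
  have hN0 : 1 ≤ N := by
    by_contra! h
    have : N = 0 := by omega
    subst this
    norm_num at hN2
    linarith
  have hNlog : N * Real.log 2 ≤ Real.log K := by
    rw [← Real.log_pow]
    exact Real.log_le_log (by positivity) hN1
  have hlog : ∀ k, Real.log (R / (R * (1 / 2) ^ n k)) = n k * Real.log 2 := by
    intro k
    rw [← Real.log_pow]
    congr 1
    rw [one_div, inv_pow, div_eq_iff (by positivity)]
    field_simp
  -- pointwise bound
  have hpt : ∀ k, Real.log (R / (R * (1 / 2) ^ n k)) ^ p ≤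
      Real.log K ^ p * (1 + (n k - N : ℕ) : ℝ) ^ p := by
    intro k
    rw [hlog, ← Real.mul_rpow hlogK.le (by positivity)]
    refine Real.rpow_le_rpow (by positivity) ?_ (by linarith)
    have hnat : n k ≤ N * (1 + (n k - N)) := by
      have : n k - N ≤ N * (n k - N) := Nat.le_mul_of_pos_left _ hN0
      rw [mul_add]; omega
    have hnat' : (n k : ℝ) ≤ N * (1 + (n k - N : ℕ)) := by exact_mod_cast hnat
    calc (n k : ℝ) * Real.log 2 ≤ N * (1 + (n k - N : ℕ)) * Real.log 2 := by gcongr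
      _ = N * Real.log 2 * (1 + (n k - N : ℕ)) := by ring
      _ ≤ _ := by gcongr
  -- volume of the levels
  have hlev : ∀ (s : Finset ℕ) (j : ℕ), ∑ k ∈ s with n k - N = j,
      volume.real (ball (c k) (R * (1 / 2) ^ n k)) ≤
      d * (18 * (1 / 2) ^ j) * volume.real (ball x₀ R) := by
    intro s j
    rw [← measureReal_biUnion_finset (fun i _ j _ hij => hdis hij)
      (fun _ _ => measurableSet_ball) (fun _ _ => measure_ball_lt_top.ne)]
    have hm : MeasurableSet (⋃ k ∈ s.filter (fun k => n k - N = j),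
        ball (c k) (R * (1 / 2) ^ n k)) :=
      Finset.measurableSet_biUnion _ fun _ _ => measurableSet_ball
    rw [measureReal_def, ← hmp.measure_preimage hm.nullMeasurableSet, ← measureReal_def]
    refine le_trans (measureReal_mono ?_ ?_) (aux_shell hd x₀ hR (by positivity))
    · intro x hx
      rw [mem_preimage] at hx
      simp only [mem_iUnion, Finset.mem_filter, exists_prop] at hx
      obtain ⟨k, ⟨_, hkj⟩, hxk⟩ := hx
      have hxB : x ∈ ball x₀ R := by rw [← hpre]; exact hsubΩ k hxk
      refine ⟨hxB, fun hx' => ?_⟩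
      rw [mem_ball] at hx'
      rcases Nat.eq_zero_or_pos j with hj | hj
      · subst hj
        have := dist_nonneg (x := x) (y := x₀)
        norm_num at hx'
        linarith
      have hnk : n k = N + j := by omega
      have hlt : infDist (φ x) Ωᶜ < 9 * (R * (1 / 2) ^ n k) := by
        have h1 : infDist (φ x) Ωᶜ ≤ infDist (c k) Ωᶜ + dist (φ x) (c k) :=
          infDist_le_infDist_add_dist
        rw [mem_ball] at hxk
        linarith [h8 k]
      obtain ⟨z, hz, hxz⟩ := (infDist_lt_iff hΩc).1 hlt
      obtain ⟨w, rfl⟩ := hb.2 z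
      have hw : w ∉ ball x₀ R := fun h => hz (mem_image_of_mem _ h)
      rw [mem_ball, not_lt] at hw
      have hxw : dist x w ≤ 18 * (1 / 2) ^ j * R := by
        calc dist x w ≤ K * dist (φ x) (φ w) := hK x w
          _ ≤ 2 ^ (N + 1) * (9 * (R * (1 / 2) ^ n k)) := by gcongr
          _ = 18 * (1 / 2) ^ j * R * (2 * (1 / 2)) ^ N := by
            rw [hnk, mul_pow]; ring
          _ = _ := by norm_num
      have := dist_triangle w x x₀
      rw [dist_comm w x] at this
      linarith
    · exact ((measure_mono sdiff_subset).trans_lt measure_ball_lt_top).ne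
  have hfin : ∑' k, (volume (ball (c k) (R * (1 / 2) ^ n k))).toReal *
      Real.log (R / (R * (1 / 2) ^ n k)) ^ p ≤
      volume.real (ball x₀ R) * (d * 18 * S * Real.log K ^ p) := by
    refine Real.tsum_le_of_sum_le ?_ ?_
    · intro k
      have : 0 ≤ Real.log (R / (R * (1 / 2) ^ n k)) := by rw [hlog]; positivity
      simp only [Pi.zero_apply]
      positivity
    intro s
    calc ∑ k ∈ s, (volume (ball (c k) (R * (1 / 2) ^ n k))).toReal *
          Real.log (R / (R * (1 / 2) ^ n k)) ^ p
        ≤ ∑ k ∈ s, volume.real (ball (c k) (R * (1 / 2) ^ n k)) *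
          (Real.log K ^ p * (1 + (n k - N : ℕ) : ℝ) ^ p) := by
          refine Finset.sum_le_sum fun k _ => ?_
          exact mul_le_mul_of_nonneg_left (hpt k) ENNReal.toReal_nonneg
      _ = ∑ j ∈ s.image (fun k => n k - N), ∑ k ∈ s with n k - N = j,
          volume.real (ball (c k) (R * (1 / 2) ^ n k)) *
          (Real.log K ^ p * (1 + (n k - N : ℕ) : ℝ) ^ p) :=
          (Finset.sum_fiberwise_of_maps_to (fun k hk => Finset.mem_image_of_mem _ hk) _).symm
      _ = ∑ j ∈ s.image (fun k => n k - N), (∑ k ∈ s with n k - N = j,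
          volume.real (ball (c k) (R * (1 / 2) ^ n k))) *
          (Real.log K ^ p * (1 + j : ℝ) ^ p) := by
          refine Finset.sum_congr rfl fun j _ => ?_
          rw [Finset.sum_mul]
          refine Finset.sum_congr rfl fun k hk => ?_
          rw [(Finset.mem_filter.1 hk).2]
      _ ≤ ∑ j ∈ s.image (fun k => n k - N), (d * (18 * (1 / 2) ^ j) * volume.real (ball x₀ R)) *
          (Real.log K ^ p * (1 + j : ℝ) ^ p) := by
          refine Finset.sum_le_sum fun j _ => ?_
          exact mul_le_mul_of_nonneg_right (hlev s j) (by positivity)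
      _ = (volume.real (ball x₀ R) * (d * 18 * Real.log K ^ p)) *
          ∑ j ∈ s.image (fun k => n k - N), (1 + j : ℝ) ^ p * (1 / 2 : ℝ) ^ j := by
          rw [Finset.mul_sum]
          refine Finset.sum_congr rfl fun j _ => ?_
          ring
      _ ≤ (volume.real (ball x₀ R) * (d * 18 * Real.log K ^ p)) * S := by
          refine mul_le_mul_of_nonneg_left ?_ (by positivity)
          exact (aux_summable p).sum_le_tsum _ (fun j _ => by positivity)
      _ = _ := by ring
  rw [one_div, inv_mul_le_iff₀ (by exact hB)]
  refine hfin.trans ?_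
  rw [← measureReal_def]
  refine mul_le_mul_of_nonneg_left ?_ hB.le
  refine mul_le_mul_of_nonneg_right ?_ (by positivity)
  push_cast
  have := Nat.le_ceil (d * 18 * S)
  have h15 : (0 : ℝ) ≤ 15 ^ d := by positivity
  linarith
end

section
/- Let d ≥ 2 and let φ : ℝ^d → ℝ^d be a bi-Lipschitz homeomorphism that preserves Lebesgue measure and is orientation preserving (the a.e. defined derivative of φ has determinant 1 almost everywhere). Suppose there is a constant k > 0 such that for every locally integrable f : ℝ^d → ℝ and every N ≥ 0, if |B|⁻¹ ∫_B |f − av_B f| ≤ N for all balls B, then |B|⁻¹ ∫_B |f∘φ − av_B(f∘φ)| ≤ k·N for all balls B. Then there is a constant C depending only on d such that log(K(φ)) ≤ C·k. -/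
open Metric MeasureTheory

theorem aux_strip {d : ℕ} (v p z : EuclideanSpace ℝ (Fin d)) (hv : ‖v‖ = 1) (r : ℝ) (hr : 0 < r)
    (j : ℕ) :
    volume (ball z r ∩ {w | |inner ℝ v (w - p)| ≤ (1/2)^j * r}) ≤
      ENNReal.ofReal (4^d * (1/2)^j) * volume (ball z r) := by
  set t : ℝ := (1/2)^j * r with ht
  have ht0 : 0 < t := by positivity
  have htj : (2:ℝ)^j * t = r := by
    rw [ht, ← mul_assoc, ← mul_pow]; norm_num
  set S := ball z r ∩ {w | |inner ℝ v (w - p)| ≤ t} with hS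
  have hSm : MeasurableSet S := by
    apply measurableSet_ball.inter
    exact (isClosed_le (by fun_prop) continuous_const).measurableSet
  let T : ℕ → Set (EuclideanSpace ℝ (Fin d)) := fun i => (fun w => (-(3 * t * i)) • v + w) ⁻¹' S
  have hTm : ∀ i, MeasurableSet (T i) := fun i => hSm.preimage (by fun_prop)
  have hTv : ∀ i, volume (T i) = volume S := fun i => measure_preimage_add _ _ _
  have hsub : (⋃ i ∈ Finset.range (2^j), T i) ⊆ ball z (4 * r) := by
    intro w hw
    simp only [Set.mem_iUnion] at hw
    obtain ⟨i, hi, hw⟩ := hw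
    have hi' : (i:ℝ) ≤ 2^j := by
      have := (Finset.mem_range.1 hi).le
      exact_mod_cast this
    have h1 : ‖(-(3 * t * i)) • v + w - z‖ < r := by simpa [dist_eq_norm] using hw.1
    have h2 : ‖(3 * t * i) • v‖ ≤ 3 * r := by
      rw [norm_smul, hv, Real.norm_of_nonneg (by positivity), ← htj]
      nlinarith
    rw [mem_ball, dist_eq_norm]
    calc ‖w - z‖ = ‖((-(3 * t * i)) • v + w - z) + (3 * t * i) • v‖ := by
            congr 1; rw [neg_smul]; abel
      _ ≤ _ := norm_add_le _ _
      _ < 4 * r := by linarith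
  have hdis : Set.PairwiseDisjoint (↑(Finset.range (2^j))) T := by
    intro i _ k _ hik
    refine Set.disjoint_left.2 fun w hwi hwk => hik ?_
    have a := hwi.2
    have b := hwk.2
    simp only [Set.mem_ofPred_eq, add_sub_assoc, inner_add_right, inner_smul_right,
      real_inner_self_eq_norm_sq, hv] at a b
    rw [abs_le] at a b
    by_contra hne
    rcases lt_or_gt_of_ne hne with h | h
    · have : (i:ℝ) + 1 ≤ k := by exact_mod_cast h
      nlinarith
    · have : (k:ℝ) + 1 ≤ i := by exact_mod_cast h
      nlinarith
  have hsum : (2:ENNReal)^j * volume S ≤ volume (ball z (4 * r)) := by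
    refine le_trans (le_of_eq ?_) (measure_mono hsub)
    rw [measure_biUnion_finset hdis (fun i _ => hTm i)]
    simp [hTv]
  have hball : volume (ball z (4*r)) = ENNReal.ofReal (4^d) * volume (ball z r) := by
    rw [Measure.addHaar_ball_of_pos _ _ (by positivity), Measure.addHaar_ball_of_pos volume z hr,
      ← mul_assoc, ← ENNReal.ofReal_mul (by positivity), finrank_euclideanSpace_fin, ← mul_pow]
  rw [hball] at hsum
  have h2 : ENNReal.ofReal ((1/2)^j) * (2:ENNReal)^j = 1 := by
    have : (2:ENNReal)^j = ENNReal.ofReal (2^j) := by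
      rw [ENNReal.ofReal_pow (by norm_num)]; norm_num
    rw [this, ← ENNReal.ofReal_mul (by positivity), ← mul_pow]; norm_num
  calc volume S = ENNReal.ofReal ((1/2)^j) * ((2:ENNReal)^j * volume S) := by
        rw [← mul_assoc, h2, one_mul]
    _ ≤ ENNReal.ofReal ((1/2)^j) * (ENNReal.ofReal (4^d) * volume (ball z r)) := by gcongr
    _ = _ := by rw [← mul_assoc, ← ENNReal.ofReal_mul (by positivity), mul_comm ((1/2:ℝ)^j)]

theorem aux_count (a : ℝ) (P : ℕ → Prop) [DecidablePred P] (hP : ∀ j : ℕ, (2:ℝ)^j ≤ a → P j) :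
    ENNReal.ofReal (Real.log (max 1 a)) ≤ ∑' j : ℕ, if P j then (1:ENNReal) else 0 := by
  rcases le_or_gt a 1 with h | h
  · rw [max_eq_left h]; simp
  rw [max_eq_right h.le]
  obtain ⟨n, hn1, hn2⟩ := exists_nat_pow_near h.le (by norm_num : (1:ℝ) < 2)
  have hlog : Real.log a ≤ (n + 1 : ℕ) := by
    calc Real.log a ≤ Real.log (2^(n+1)) := Real.log_le_log (by linarith) hn2.le
      _ = (n+1 : ℕ) * Real.log 2 := by rw [Real.log_pow]
      _ ≤ (n+1 : ℕ) * 1 := by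
        have := Real.log_two_lt_d9
        gcongr; linarith
      _ = _ := by ring
  calc ENNReal.ofReal (Real.log a) ≤ ENNReal.ofReal ((n + 1 : ℕ) : ℝ) := ENNReal.ofReal_le_ofReal hlog
    _ = ∑ j ∈ Finset.range (n+1), (if P j then (1:ENNReal) else 0) := by
      rw [Finset.sum_congr rfl (g := fun _ => (1:ENNReal)), ENNReal.ofReal_natCast]
      · simp
      · intro j hj
        rw [if_pos]
        apply hP
        refine le_trans ?_ hn1
        exact pow_le_pow_right₀ (by norm_num) (Nat.lt_succ_iff.1 (Finset.mem_range.1 hj))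
    _ ≤ _ := ENNReal.sum_le_tsum _

theorem aux_bmo {d : ℕ} (v p z : EuclideanSpace ℝ (Fin d)) (hv : ‖v‖ = 1) (r : ℝ) (hr : 0 < r)
    (f H : EuclideanSpace ℝ (Fin d) → ℝ) (hf : Continuous f) (hH0 : ∀ w, 0 < H w)
    (hH : ∀ w, |inner ℝ v (w - p)| ≤ H w) (c M : ℝ) (hM : 0 ≤ M)
    (hfc : ∀ w ∈ ball z r, |f w - c| ≤ M + Real.log (max 1 (r / H w))) :
    ⨍ y in ball z r, |f y - ⨍ x in ball z r, f x| ≤ 2 * (M + 2 * 4^d) := by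
  classical
  have hB0 : volume (ball z r) ≠ 0 := (measure_ball_pos _ _ hr).ne'
  have hBt : volume (ball z r) ≠ ⊤ := measure_ball_lt_top.ne
  have hIntg : ∀ g : EuclideanSpace ℝ (Fin d) → ℝ, Continuous g → IntegrableOn g (ball z r) volume :=
    fun g hg => (hg.continuousOn.integrableOn_compact (isCompact_closedBall z r)).mono_set
      ball_subset_closedBall
  have key : ∫⁻ w in ball z r, ENNReal.ofReal |f w - c| ≤
      ENNReal.ofReal (M + 2 * 4^d) * volume (ball z r) := by
    let A : ℕ → Set (EuclideanSpace ℝ (Fin d)) := fun j => {w | |inner ℝ v (w - p)| ≤ (1/2)^j * r}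
    have hA : ∀ j, MeasurableSet (A j) := fun j =>
      (isClosed_le (by fun_prop) continuous_const).measurableSet
    calc ∫⁻ w in ball z r, ENNReal.ofReal |f w - c|
        ≤ ∫⁻ w in ball z r, (ENNReal.ofReal M + ∑' j, (A j).indicator 1 w) := by
          apply setLIntegral_mono' measurableSet_ball
          intro w hw
          refine (ENNReal.ofReal_le_ofReal (hfc w hw)).trans ?_
          refine ENNReal.ofReal_add_le.trans ?_
          gcongr
          simp only [Set.indicator_apply, Pi.one_apply]
          apply aux_count
          intro j hj
          change |inner ℝ v (w - p)| ≤ (1/2)^j * r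
          refine (hH w).trans ?_
          rw [le_div_iff₀ (hH0 w)] at hj
          calc H w = (1/2)^j * (2^j * H w) := by rw [← mul_assoc, ← mul_pow]; norm_num
            _ ≤ _ := by gcongr
      _ = ENNReal.ofReal M * volume (ball z r) + ∑' j, volume (ball z r ∩ A j) := by
          rw [lintegral_add_left measurable_const, setLIntegral_const, lintegral_tsum]
          · congr 1
            refine tsum_congr fun j => ?_
            rw [lintegral_indicator_one (hA j), Measure.restrict_apply (hA j), Set.inter_comm]
          · intro j
            exact (measurable_one.indicator (hA j)).aemeasurable
      _ ≤ ENNReal.ofReal M * volume (ball z r) +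
            ∑' j : ℕ, ENNReal.ofReal (4^d * (1/2)^j) * volume (ball z r) := by
          gcongr with j
          exact aux_strip v p z hv r hr j
      _ = _ := by
          rw [ENNReal.tsum_mul_right, ← ENNReal.ofReal_tsum_of_nonneg (fun j => by positivity)
            (summable_geometric_two.mul_left _), tsum_mul_left, tsum_geometric_two, ← add_mul,
            ← ENNReal.ofReal_add hM (by positivity), mul_comm (4^d : ℝ)]
  have hv0 : 0 < volume.real (ball z r) := ENNReal.toReal_pos hB0 hBt
  have hav : ⨍ y in ball z r, |f y - c| ≤ M + 2 * 4^d := by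
    rw [setAverage_eq, smul_eq_mul, inv_mul_le_iff₀ hv0,
      integral_eq_lintegral_of_nonneg_ae (Filter.Eventually.of_forall fun _ => abs_nonneg _)
        (by fun_prop)]
    refine (ENNReal.toReal_mono (ENNReal.mul_ne_top ENNReal.ofReal_ne_top hBt) key).trans ?_
    rw [ENNReal.toReal_mul, ENNReal.toReal_ofReal (by positivity), mul_comm]; rfl
  set a := ⨍ x in ball z r, f x with ha
  have hac : |c - a| ≤ ⨍ y in ball z r, |f y - c| := by
    have : a - c = ⨍ y in ball z r, (f y - c) := by
      rw [ha, setAverage_eq, setAverage_eq, integral_sub (hIntg f hf) (hIntg _ continuous_const)]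
      simp only [smul_eq_mul, setIntegral_const, mul_sub]
      field_simp
    rw [abs_sub_comm, this, setAverage_eq, setAverage_eq, smul_eq_mul, smul_eq_mul, abs_mul,
      abs_of_pos (inv_pos.2 hv0)]
    gcongr
    exact abs_integral_le_integral_abs
  calc ⨍ y in ball z r, |f y - a| ≤ ⨍ y in ball z r, (|f y - c| + |c - a|) := by
        rw [setAverage_eq, setAverage_eq, smul_eq_mul, smul_eq_mul]
        refine mul_le_mul_of_nonneg_left ?_ (inv_pos.2 hv0).le
        exact setIntegral_mono (hIntg _ (by fun_prop)) (hIntg _ (by fun_prop))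
          fun y => abs_sub_le _ _ _
    _ = (⨍ y in ball z r, |f y - c|) + |c - a| := by
        rw [setAverage_eq, setAverage_eq, integral_add (hIntg _ (by fun_prop)) (hIntg _ (by fun_prop))]
        simp only [smul_eq_mul, setIntegral_const, mul_add]
        field_simp
    _ ≤ _ := by linarith

theorem aux_logmax (a b M : ℝ) (hM : 1 ≤ M) (h1 : a ≤ M * b) (h2 : b ≤ M * a) :
    |Real.log (max 1 a) - Real.log (max 1 b)| ≤ Real.log M := by
  have key : ∀ a b : ℝ, a ≤ M * b → Real.log (max 1 a) ≤ Real.log M + Real.log (max 1 b) := by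
    intro a b h
    have hb : (1:ℝ) ≤ max 1 b := le_max_left _ _
    rw [← Real.log_mul (by positivity) (by positivity)]
    apply Real.log_le_log (by positivity)
    apply max_le
    · nlinarith
    · exact h.trans (by gcongr; exact le_max_right _ _)
  rw [abs_le]
  constructor
  · linarith [key b a h2]
  · linarith [key a b h1]

/-- odd truncated logarithm -/
noncomputable def auxPsi (s : ℝ) : ℝ := Real.log (max 1 s) - Real.log (max 1 (-s))

theorem auxPsi_neg (s : ℝ) : auxPsi (-s) = - auxPsi s := by
  simp [auxPsi]

theorem auxPsi_of_nonneg {s : ℝ} (hs : 0 ≤ s) : auxPsi s = Real.log (max 1 s) := by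
  have : max 1 (-s) = 1 := max_eq_left (by linarith)
  simp [auxPsi, this]

theorem auxPsi_continuous : Continuous auxPsi := by
  unfold auxPsi
  refine Continuous.sub ?_ ?_
  · exact Continuous.log (by fun_prop) fun s => (lt_of_lt_of_le one_pos (le_max_left _ _)).ne'
  · exact Continuous.log (by fun_prop) fun s => (lt_of_lt_of_le one_pos (le_max_left _ _)).ne'

theorem abs_auxPsi (s : ℝ) : |auxPsi s| = Real.log (max 1 |s|) := by
  have pos : ∀ s : ℝ, 0 ≤ s → |auxPsi s| = Real.log (max 1 |s|) := by
    intro s hs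
    rw [auxPsi_of_nonneg hs, abs_of_nonneg hs, abs_of_nonneg]
    exact Real.log_nonneg (le_max_left _ _)
  rcases le_total 0 s with h | h
  · exact pos s h
  · have := pos (-s) (by linarith)
    rwa [auxPsi_neg, abs_neg, abs_neg] at this

theorem aux_pointwise_pos {E : Type*} [PseudoMetricSpace E] (h H : E → ℝ) (hH0 : ∀ w, 0 < H w)
    (hL : ∀ w w', |h w - h w'| ≤ dist w w') (hHL : ∀ w w', |H w - H w'| ≤ dist w w')
    (S : ℝ) (hS : 2 ≤ S) (z : E) (r : ℝ) (hr : 0 < r) (hz : 2 * r ≤ h z) :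
    ∃ c, ∀ w ∈ ball z r, |auxPsi (S * h w / H w) - c| ≤ Real.log (3 * S) + Real.log (max 1 (r / H w)) := by
  have hm : ∀ w, (1:ℝ) ≤ max 1 (r / H w) := fun w => le_max_left _ _
  have hh : ∀ w ∈ ball z r, h z ≤ 2 * h w ∧ h w ≤ 2 * h z := by
    intro w hw
    have := abs_le.1 ((hL w z).trans (mem_ball.1 hw).le)
    constructor <;> linarith
  rcases le_or_gt (2 * r) (H z) with hHz | hHz
  · refine ⟨Real.log (max 1 (S * h z / H z)), fun w hw => ?_⟩
    obtain ⟨a1, a2⟩ := hh w hw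
    have := abs_le.1 ((hL w z).trans (mem_ball.1 hw).le)
    have b := abs_le.1 ((hHL w z).trans (mem_ball.1 hw).le)
    have hw0 := hH0 w
    have hz0 := hH0 z
    have hhw : 0 < h w := by linarith
    rw [auxPsi_of_nonneg (by positivity)]
    have h3 : Real.log 3 ≤ Real.log (3 * S) + Real.log (max 1 (r / H w)) := by
      have h0 := Real.log_nonneg (hm w)
      have : Real.log 3 ≤ Real.log (3 * S) := Real.log_le_log (by norm_num) (by linarith)
      linarith
    refine (aux_logmax _ _ 3 (by norm_num) ?_ ?_).trans h3
    · rw [← mul_div_assoc, div_le_div_iff₀ hw0 hz0]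
      have : h w * H z ≤ 3 * (h z * H w) := by nlinarith
      nlinarith
    · rw [← mul_div_assoc, div_le_div_iff₀ hz0 hw0]
      have : h z * H w ≤ 3 * (h w * H z) := by nlinarith
      nlinarith
  · refine ⟨Real.log (max 1 (S * h z / r)), fun w hw => ?_⟩
    obtain ⟨a1, a2⟩ := hh w hw
    have b := abs_le.1 ((hHL w z).trans (mem_ball.1 hw).le)
    have hw0 := hH0 w
    have hz0 := hH0 z
    have hhw : 0 < h w := by linarith
    have hmw := hm w
    rw [auxPsi_of_nonneg (by positivity), ← Real.log_mul (by positivity) (by positivity)]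
    refine aux_logmax _ _ _ (by nlinarith) ?_ ?_
    · rw [div_le_iff₀ hw0]
      have h1 : r ≤ max 1 (r / H w) * H w := by
        rw [← div_le_iff₀ hw0]; exact le_max_right _ _
      calc S * h w ≤ S * (3 * S * h z) := by
            have : h w ≤ 3 * S * h z := by nlinarith
            gcongr
        _ = 3 * S * (S * h z / r) * r := by field_simp
        _ ≤ 3 * S * (S * h z / r) * (max 1 (r / H w) * H w) := by
          have : 0 < h z := by linarith
          gcongr
        _ = _ := by ring
    · rw [div_le_iff₀ hr]
      calc S * h z ≤ S * (2 * h w) := by gcongr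
        _ = S * h w / H w * (2 * H w) := by field_simp
        _ ≤ S * h w / H w * (2 * (3 * r)) := by
          have : H w ≤ 3 * r := by linarith
          gcongr
        _ ≤ S * h w / H w * ((3 * S * max 1 (r / H w)) * r) := by
          have h6 : 2 * 3 ≤ 3 * S * max 1 (r / H w) := by nlinarith
          exact mul_le_mul_of_nonneg_left (by nlinarith) (by positivity)
        _ = _ := by ring

theorem aux_pointwise {E : Type*} [PseudoMetricSpace E] (h H : E → ℝ) (hH0 : ∀ w, 0 < H w)
    (hL : ∀ w w', |h w - h w'| ≤ dist w w') (hHL : ∀ w w', |H w - H w'| ≤ dist w w')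
    (S : ℝ) (hS : 2 ≤ S) (z : E) (r : ℝ) (hr : 0 < r) :
    ∃ c, ∀ w ∈ ball z r, |auxPsi (S * h w / H w) - c| ≤ Real.log (3 * S) + Real.log (max 1 (r / H w)) := by
  rcases le_or_gt (2 * r) (h z) with h1 | h1
  · exact aux_pointwise_pos h H hH0 hL hHL S hS z r hr h1
  rcases le_or_gt (2 * r) (- h z) with h2 | h2
  · obtain ⟨c, hc⟩ := aux_pointwise_pos (fun w => - h w) H hH0
      (fun w w' => by rw [← abs_neg]; convert hL w w' using 2; ring) hHL S hS z r hr h2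
    refine ⟨-c, fun w hw => ?_⟩
    have := hc w hw
    rw [← abs_neg]
    convert this using 2
    rw [show S * -h w / H w = - (S * h w / H w) by ring, auxPsi_neg]
    ring
  · refine ⟨0, fun w hw => ?_⟩
    have a := abs_le.1 ((hL w z).trans (mem_ball.1 hw).le)
    have h3 : |h w| ≤ 3 * r := by rw [abs_le]; constructor <;> linarith
    have hw0 := hH0 w
    have hm : (1:ℝ) ≤ max 1 (r / H w) := le_max_left _ _
    have hm' : (r / H w) ≤ max 1 (r / H w) := le_max_right _ _
    rw [sub_zero, abs_auxPsi, ← Real.log_mul (by positivity) (by positivity)]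
    apply Real.log_le_log (by positivity)
    apply max_le
    · nlinarith
    · rw [abs_div, abs_mul, abs_of_pos hw0, abs_of_pos (by linarith : 0 < S)]
      calc S * |h w| / H w ≤ S * (3 * r) / H w := by gcongr
        _ = 3 * S * (r / H w) := by ring
        _ ≤ _ := by gcongr

theorem aux_lip {E : Type*} [NormedAddCommGroup E] [NormedSpace ℝ E] [FiniteDimensional ℝ E]
    [MeasurableSpace E] [BorelSpace E] (μ : Measure E) [μ.IsAddHaarMeasure]
    (f : E → E) (A : NNReal) (hf : LipschitzWith A f)
    (D : E → E →L[ℝ] E) (Q : ℝ) (hD : ∀ᵐ x ∂μ, HasFDerivAt f (D x) x ∧ ‖D x‖ ≤ Q) (hQ : 0 ≤ Q)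
    (x v : E) : ‖f (x + v) - f x‖ ≤ Q * ‖v‖ := by
  have hstep : ∀ r : ℝ, 0 < r → ‖f (x + v) - f x‖ ≤ Q * ‖v‖ + 2 * A * r := by
    intro r hr
    have hB0 : μ (ball x r) ≠ 0 := (measure_ball_pos _ _ hr).ne'
    have hBt : μ (ball x r) ≠ ⊤ := measure_ball_lt_top.ne
    have hv0 : 0 < μ.real (ball x r) := ENNReal.toReal_pos hB0 hBt
    have hIntg : ∀ g : E → E, Continuous g → IntegrableOn g (ball x r) μ :=
      fun g hg => (hg.continuousOn.integrableOn_compact (isCompact_closedBall x r)).mono_set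
        ball_subset_closedBall
    have hae : ∀ t : ℝ, ∀ᵐ z ∂μ, HasFDerivAt f (D (z + t • v)) (z + t • v) ∧ ‖D (z + t • v)‖ ≤ Q :=
      fun t => (measurePreserving_add_right μ (t • v)).quasiMeasurePreserving.ae hD
    have hder : ∀ t : ℝ, HasDerivAt (fun t : ℝ => ∫ z in ball x r, f (z + t • v) ∂μ)
        (∫ z in ball x r, fderiv ℝ f (z + t • v) v ∂μ) t := by
      intro t
      refine (hasDerivAt_integral_of_dominated_loc_of_lip (bound := fun _ => (A * ‖v‖ : ℝ))
        Filter.univ_mem ?_ ?_ ?_ ?_ ?_ ?_).2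
      · refine Filter.Eventually.of_forall fun s => ?_
        exact (hf.continuous.comp (by fun_prop)).aestronglyMeasurable
      · exact hIntg _ (hf.continuous.comp (by fun_prop))
      · have := (measurable_fderiv_apply_const ℝ f v).comp (measurable_add_const (t • v))
        exact this.aestronglyMeasurable
      · refine Filter.Eventually.of_forall fun z => LipschitzOnWith.of_dist_le_mul ?_
        intro s _ s' _
        refine (hf.dist_le_mul _ _).trans (le_of_eq ?_)
        rw [dist_add_left, dist_eq_norm, ← sub_smul, norm_smul, dist_eq_norm]
        simp only [Real.coe_nnabs]
        rw [abs_of_nonneg (by positivity)]; ring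
      · exact integrable_const_iff.2 (Or.inr ⟨by simpa using hBt.lt_top⟩)
      · refine ae_restrict_of_ae ((hae t).mono fun z hz => ?_)
        have h1 : HasDerivAt (fun s : ℝ => z + s • v) v t := by
          simpa using ((hasDerivAt_id t).smul_const v).const_add z
        have := hz.1.comp_hasDerivAt t h1
        rw [hz.1.fderiv]
        exact this
    have hbd : ∀ t : ℝ, ‖∫ z in ball x r, fderiv ℝ f (z + t • v) v ∂μ‖ ≤ Q * ‖v‖ * μ.real (ball x r) := by
      intro t
      apply norm_setIntegral_le_of_norm_le_const_ae hBt.lt_top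
      refine ae_restrict_of_ae ((hae t).mono fun z hz => ?_)
      rw [hz.1.fderiv]
      exact (ContinuousLinearMap.le_opNorm _ _).trans (by gcongr; exact hz.2)
    have hmv := norm_image_sub_le_of_norm_deriv_le_segment_01'
      (fun t _ => (hder t).hasDerivWithinAt) (fun t _ => hbd t)
    simp only [one_smul, zero_smul, add_zero] at hmv
    have h2 : ‖∫ z in ball x r, ((f (x + v) - f x) - (f (z + v) - f z)) ∂μ‖ ≤
        2 * A * r * μ.real (ball x r) := by
      apply norm_setIntegral_le_of_norm_le_const hBt.lt_top
      intro z hz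
      have e1 := hf.dist_le_mul (x + v) (z + v)
      have e2 := hf.dist_le_mul z x
      rw [dist_add_right, dist_comm x z, dist_eq_norm] at e1
      rw [dist_eq_norm] at e2
      have hz' : (A:ℝ) * dist z x ≤ A * r := by gcongr; exact (mem_ball.1 hz).le
      calc _ = ‖(f (x + v) - f (z + v)) + (f z - f x)‖ := by congr 1; abel
        _ ≤ _ := norm_add_le _ _
        _ ≤ _ := by linarith
    have hc1 : Continuous (fun z => f (z + v)) := hf.continuous.comp (by fun_prop)
    rw [integral_sub (hIntg _ continuous_const) (hIntg (fun z => f (z + v) - f z) (hc1.sub hf.continuous)),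
      integral_sub (hIntg _ hc1) (hIntg _ hf.continuous), setIntegral_const] at h2
    have h3 : ‖μ.real (ball x r) • (f (x + v) - f x)‖ ≤
        (Q * ‖v‖ + 2 * A * r) * μ.real (ball x r) := by
      refine (norm_le_norm_add_norm_sub' _ _).trans ((add_le_add hmv h2).trans (le_of_eq ?_))
      ring
    rw [norm_smul, Real.norm_of_nonneg hv0.le, mul_comm] at h3
    exact le_of_mul_le_mul_right h3 hv0
  refine le_of_forall_pos_le_add fun ε hε => ?_
  refine (hstep (ε / (2 * A + 1)) (by positivity)).trans ?_
  gcongr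
  rw [mul_div_assoc', div_le_iff₀ (by positivity)]
  nlinarith

theorem aux_det {d : ℕ} (hd : 0 < d)
    (B : EuclideanSpace ℝ (Fin d) →L[ℝ] EuclideanSpace ℝ (Fin d))
    (hB : LinearMap.det (B : EuclideanSpace ℝ (Fin d) →ₗ[ℝ] EuclideanSpace ℝ (Fin d)) = 1) :
    1 ≤ ‖B‖ := by
  by_contra! hlt
  have hsub : B '' (closedBall 0 1) ⊆ closedBall 0 ‖B‖ := by
    rintro _ ⟨y, hy, rfl⟩
    rw [mem_closedBall_zero_iff] at hy ⊢
    exact (B.le_opNorm y).trans (mul_le_of_le_one_right (norm_nonneg _) hy)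
  have := measure_mono (μ := volume) hsub
  rw [Measure.addHaar_image_continuousLinearMap, hB, Measure.addHaar_closedBall _ _ (norm_nonneg _),
    Measure.addHaar_closedBall _ _ zero_le_one, finrank_euclideanSpace_fin] at this
  have hb0 : volume (ball (0:EuclideanSpace ℝ (Fin d)) 1) ≠ 0 := (measure_ball_pos _ _ one_pos).ne'
  have hbt : volume (ball (0:EuclideanSpace ℝ (Fin d)) 1) ≠ ⊤ := measure_ball_lt_top.ne
  simp only [abs_one, ENNReal.ofReal_one, one_pow, one_mul] at this
  have h1 : (1:ENNReal) ≤ ENNReal.ofReal (‖B‖^d) := by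
    by_contra! h
    have := ENNReal.mul_lt_mul_left hb0 hbt h
    rw [one_mul] at this
    exact absurd this (not_lt.2 ‹_›)
  rw [ENNReal.one_le_ofReal] at h1
  exact absurd h1 (not_le.2 (pow_lt_one₀ (norm_nonneg _) hlt hd.ne'))

theorem aux_avg {d : ℕ} (g : EuclideanSpace ℝ (Fin d) → ℝ) (hg : Continuous g)
    (x e : EuclideanSpace ℝ (Fin d)) (he : ‖e‖ = 1) (r L : ℝ) (hr : 0 < r)
    (hp : ∀ z ∈ ball (x + (r/2) • e) (r/4), L ≤ g z)
    (hm : ∀ z ∈ ball (x - (r/2) • e) (r/4), g z ≤ -L) (a : ℝ) :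
    L ≤ 4^d * ⨍ y in ball x r, |g y - a| := by
  have hB0 : volume (ball x r) ≠ 0 := (measure_ball_pos _ _ hr).ne'
  have hBt : volume (ball x r) ≠ ⊤ := measure_ball_lt_top.ne
  have hv0 : 0 < volume.real (ball x r) := ENNReal.toReal_pos hB0 hBt
  have hIntg : ∀ g : EuclideanSpace ℝ (Fin d) → ℝ, Continuous g → IntegrableOn g (ball x r) volume :=
    fun g hg => (hg.continuousOn.integrableOn_compact (isCompact_closedBall x r)).mono_set
      ball_subset_closedBall
  have hgi := hIntg (fun y => |g y - a|) (by fun_prop)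
  have main : ∀ q, dist q x ≤ r / 2 → (∀ z ∈ ball q (r/4), L ≤ |g z - a|) →
      L ≤ 4^d * ⨍ y in ball x r, |g y - a| := by
    intro q hq hz
    have hsub : ball q (r/4) ⊆ ball x r := ball_subset_ball' (by linarith)
    have hvol : volume.real (ball x r) = 4^d * volume.real (ball q (r/4)) := by
      rw [Measure.real, Measure.real, Measure.addHaar_ball_of_pos _ _ hr,
        Measure.addHaar_ball_of_pos _ q (by positivity : 0 < r/4), ENNReal.toReal_mul,
        ENNReal.toReal_mul, ENNReal.toReal_ofReal (by positivity),
        ENNReal.toReal_ofReal (by positivity), finrank_euclideanSpace_fin, ← mul_assoc, ← mul_pow]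
      congr 2; ring
    have h1 : L * volume.real (ball q (r/4)) ≤ ∫ y in ball x r, |g y - a| := by
      calc L * volume.real (ball q (r/4)) = ∫ y in ball q (r/4), L := by
            rw [setIntegral_const, smul_eq_mul, mul_comm]
        _ ≤ ∫ y in ball q (r/4), |g y - a| :=
            setIntegral_mono_on (integrableOn_const measure_ball_lt_top.ne) (hgi.mono_set hsub)
              measurableSet_ball hz
        _ ≤ _ := setIntegral_mono_set hgi (Filter.Eventually.of_forall fun _ => abs_nonneg _)
            hsub.eventuallyLE
    rw [setAverage_eq, smul_eq_mul, ← mul_assoc, mul_comm, ← mul_assoc, ← div_eq_mul_inv,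
      le_div_iff₀ hv0, hvol]
    have : (0:ℝ) < 4^d := by positivity
    nlinarith
  rcases le_total a 0 with ha | ha
  · refine main (x + (r/2) • e) ?_ fun z hz => ?_
    · rw [dist_eq_norm, add_sub_cancel_left, norm_smul, he, Real.norm_of_nonneg (by positivity)]
      linarith
    · have := hp z hz
      exact le_trans (by linarith) (le_abs_self _)
  · refine main (x - (r/2) • e) ?_ fun z hz => ?_
    · rw [dist_eq_norm, sub_sub_cancel_left, norm_neg, norm_smul, he,
        Real.norm_of_nonneg (by positivity)]
      linarith
    · have := hm z hz
      exact le_trans (by linarith) (neg_le_abs _)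

theorem aux_innerLip {d : ℕ} (u p : EuclideanSpace ℝ (Fin d)) (hu : ‖u‖ = 1)
    (w w' : EuclideanSpace ℝ (Fin d)) :
    |inner ℝ u (w - p) - inner ℝ u (w' - p)| ≤ dist w w' := by
  rw [← inner_sub_right, sub_sub_sub_cancel_right, dist_eq_norm]
  simpa [hu] using abs_real_inner_le_norm u (w - w')

theorem aux_key {d : ℕ} (φ : EuclideanSpace ℝ (Fin d) → EuclideanSpace ℝ (Fin d))
    (hφ : Continuous φ) (k : ℝ)
    (hk : ∀ (f : EuclideanSpace ℝ (Fin d) → ℝ), LocallyIntegrable f volume →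
            ∀ N : ℝ, 0 ≤ N →
              (∀ (x : EuclideanSpace ℝ (Fin d)) (r : ℝ), 0 < r →
                ⨍ y in ball x r, |f y - ⨍ z in ball x r, f z| ≤ N) →
              (∀ (x : EuclideanSpace ℝ (Fin d)) (r : ℝ), 0 < r →
                ⨍ y in ball x r, |f (φ y) - ⨍ z in ball x r, f (φ z)| ≤ k * N))
    (x : EuclideanSpace ℝ (Fin d)) (D : EuclideanSpace ℝ (Fin d) →L[ℝ] EuclideanSpace ℝ (Fin d))
    (hD : HasFDerivAt φ D x) (u v : EuclideanSpace ℝ (Fin d)) (hu : ‖u‖ = 1) (hv : ‖v‖ = 1)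
    (hu0 : 0 < ‖D.adjoint u‖) (hv0 : 0 < ‖D.adjoint v‖) :
    1 + Real.log (‖D.adjoint u‖ / ‖D.adjoint v‖) ≤
      4^d * (k * (2 * (Real.log (3 * (16 * Real.exp 1)) + 2 * 4^d))) := by
  set l := ‖D.adjoint u‖ with hl
  set m := ‖D.adjoint v‖ with hm
  set S : ℝ := 16 * Real.exp 1 with hS
  have hS2 : 2 ≤ S := by have := Real.add_one_le_exp (1:ℝ); linarith
  have hlogS : 0 ≤ Real.log (3 * S) := Real.log_nonneg (by linarith)
  obtain ⟨δ, hδ0, hδl, hδm⟩ : ∃ δ : ℝ, 0 < δ ∧ δ ≤ l / 8 ∧ δ ≤ m :=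
    ⟨min (l/8) m, by positivity, min_le_left _ _, min_le_right _ _⟩
  have hev := hD.isLittleO.def hδ0
  obtain ⟨r, hr, hball⟩ := Metric.eventually_nhds_iff_ball.1 hev
  let h : EuclideanSpace ℝ (Fin d) → ℝ := fun w => inner ℝ u (w - φ x)
  let H : EuclideanSpace ℝ (Fin d) → ℝ := fun w => max |inner ℝ v (w - φ x)| (m * r)
  have hmr : 0 < m * r := by positivity
  have hH0 : ∀ w, 0 < H w := fun w => lt_of_lt_of_le hmr (le_max_right _ _)
  have hhc : Continuous h := by fun_prop
  have hHc : Continuous H := by fun_prop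
  let f : EuclideanSpace ℝ (Fin d) → ℝ := fun w => auxPsi (S * h w / H w)
  have hfc : Continuous f :=
    auxPsi_continuous.comp ((continuous_const.mul hhc).div hHc fun w => (hH0 w).ne')
  have hbmo := hk f hfc.locallyIntegrable (2 * (Real.log (3 * S) + 2 * 4^d)) (by positivity) (by
    intro z ρ hρ
    obtain ⟨c, hc⟩ := aux_pointwise h H hH0 (fun w w' => aux_innerLip u (φ x) hu w w')
      (fun w w' => by
        refine (abs_max_sub_max_le_abs _ _ _).trans ?_
        exact (abs_abs_sub_abs_le _ _).trans (aux_innerLip v (φ x) hv w w')) S hS2 z ρ hρ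
    exact aux_bmo v (φ x) z hv ρ hρ f H hfc hH0 (fun w => le_max_left _ _) c _ hlogS hc) x r hr
  -- approximation on the ball
  have happ : ∀ a : EuclideanSpace ℝ (Fin d), ‖a‖ = 1 → ∀ z ∈ ball x r,
      |inner ℝ a (φ z - φ x) - inner ℝ (D.adjoint a) (z - x)| ≤ δ * r := by
    intro a ha z hz
    have h1 := hball z hz
    rw [ContinuousLinearMap.adjoint_inner_left, ← inner_sub_right]
    refine (abs_real_inner_le_norm _ _).trans ?_
    rw [ha, one_mul]
    refine h1.trans ?_
    have : ‖z - x‖ ≤ r := by rw [← dist_eq_norm]; exact (mem_ball.1 hz).le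
    gcongr
  have hHle : ∀ z ∈ ball x r, H (φ z) ≤ 2 * m * r := by
    intro z hz
    refine max_le ?_ (by nlinarith)
    have h1 := abs_le.1 (happ v hv z hz)
    have h2 := abs_le.1 (abs_real_inner_le_norm (D.adjoint v) (z - x))
    have h3 : ‖z - x‖ ≤ r := by rw [← dist_eq_norm]; exact (mem_ball.1 hz).le
    have h4 : m * ‖z - x‖ ≤ m * r := by gcongr
    have h5 : δ * r ≤ m * r := by gcongr
    rw [← hm] at h2
    rw [abs_le]
    constructor <;> linarith [h1.1, h1.2, h2.1, h2.2]
  have hlow : ∀ z ∈ ball x r, l * r / 8 ≤ h (φ z) → 1 + Real.log (l / m) ≤ f (φ z) := by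
    intro z hz hhz
    have hHz := hH0 (φ z)
    have hhz0 : 0 < h (φ z) := lt_of_lt_of_le (by positivity) hhz
    change _ ≤ auxPsi _
    rw [auxPsi_of_nonneg (by positivity)]
    have : 1 + Real.log (l / m) = Real.log (Real.exp 1 * (l / m)) := by
      rw [Real.log_mul (by positivity) (by positivity), Real.log_exp]
    rw [this]
    apply Real.log_le_log (by positivity)
    refine le_trans ?_ (le_max_right _ _)
    rw [le_div_iff₀ hHz]
    calc Real.exp 1 * (l / m) * H (φ z) ≤ Real.exp 1 * (l / m) * (2 * m * r) := by
          gcongr; exact hHle z hz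
      _ = S * (l * r / 8) := by rw [hS]; field_simp; ring
      _ ≤ _ := by gcongr
  have hlow' : ∀ z ∈ ball x r, h (φ z) ≤ -(l * r / 8) → f (φ z) ≤ -(1 + Real.log (l / m)) := by
    intro z hz hhz
    have hHz := hH0 (φ z)
    have hhz0 : 0 < -h (φ z) := lt_of_lt_of_le (by positivity : 0 < l * r / 8) (by linarith)
    change auxPsi _ ≤ _
    rw [show S * h (φ z) / H (φ z) = -(S * (-h (φ z)) / H (φ z)) by ring, auxPsi_neg,
      auxPsi_of_nonneg (by positivity), neg_le_neg_iff]
    have : 1 + Real.log (l / m) = Real.log (Real.exp 1 * (l / m)) := by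
      rw [Real.log_mul (by positivity) (by positivity), Real.log_exp]
    rw [this]
    apply Real.log_le_log (by positivity)
    refine le_trans ?_ (le_max_right _ _)
    rw [le_div_iff₀ hHz]
    calc Real.exp 1 * (l / m) * H (φ z) ≤ Real.exp 1 * (l / m) * (2 * m * r) := by
          gcongr; exact hHle z hz
      _ = S * (l * r / 8) := by rw [hS]; field_simp; ring
      _ ≤ _ := by gcongr; linarith
  let e : EuclideanSpace ℝ (Fin d) := l⁻¹ • D.adjoint u
  have he : ‖e‖ = 1 := by
    rw [norm_smul, ← hl, norm_inv, Real.norm_of_nonneg hu0.le]; field_simp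
  have hDe : D.adjoint u = l • e := by
    simp only [e]; rw [smul_smul, mul_inv_cancel₀ hu0.ne', one_smul]
  have hδr : δ * r ≤ l * r / 8 := by nlinarith
  have havg := aux_avg (fun z => f (φ z)) (hfc.comp hφ) x e he r (1 + Real.log (l / m)) hr
    (by
      intro z hz
      have hz' : ‖z - (x + (r/2) • e)‖ < r / 4 := by rw [← dist_eq_norm]; exact mem_ball.1 hz
      have hzx : z ∈ ball x r := by
        refine ball_subset_ball' ?_ hz
        rw [dist_eq_norm, add_sub_cancel_left, norm_smul, he, Real.norm_of_nonneg (by positivity)]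
        linarith
      apply hlow z hzx
      have h1 := abs_le.1 (happ u hu z hzx)
      have h2 := abs_le.1 (abs_real_inner_le_norm e (z - (x + (r/2) • e)))
      have h3 : inner ℝ e (z - (x + (r/2) • e)) = inner ℝ e (z - x) - r / 2 := by
        rw [← sub_sub, inner_sub_right, inner_smul_right, real_inner_self_eq_norm_sq, he]; ring
      rw [h3, he, one_mul] at h2
      rw [hDe, real_inner_smul_left] at h1
      change _ ≤ inner ℝ u (φ z - φ x)
      have h4 : l * (r / 4) ≤ l * inner ℝ e (z - x) := by
        apply mul_le_mul_of_nonneg_left _ hu0.le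
        linarith [h2.1]
      linarith [h1.1])
    (by
      intro z hz
      have hz' : ‖z - (x - (r/2) • e)‖ < r / 4 := by rw [← dist_eq_norm]; exact mem_ball.1 hz
      have hzx : z ∈ ball x r := by
        refine ball_subset_ball' ?_ hz
        rw [dist_eq_norm, sub_sub_cancel_left, norm_neg, norm_smul, he,
          Real.norm_of_nonneg (by positivity)]
        linarith
      apply hlow' z hzx
      have h1 := abs_le.1 (happ u hu z hzx)
      have h2 := abs_le.1 (abs_real_inner_le_norm e (z - (x - (r/2) • e)))
      have h3 : inner ℝ e (z - (x - (r/2) • e)) = inner ℝ e (z - x) + r / 2 := by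
        rw [← sub_add, inner_add_right, inner_smul_right, real_inner_self_eq_norm_sq, he]; ring
      rw [h3, he, one_mul] at h2
      rw [hDe, real_inner_smul_left] at h1
      change inner ℝ u (φ z - φ x) ≤ _
      have h4 : l * inner ℝ e (z - x) ≤ l * (-(r / 4)) := by
        apply mul_le_mul_of_nonneg_left _ hu0.le
        linarith [h2.2]
      linarith [h1.2])
    (⨍ z in ball x r, f (φ z))
  refine havg.trans ?_
  gcongr

/-- operator norm bounds from the key estimate -/
theorem aux_opnorm {d : ℕ} (hd : 0 < d)
    (D : EuclideanSpace ℝ (Fin d) ≃L[ℝ] EuclideanSpace ℝ (Fin d))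
    (hdet : LinearMap.det ((D : EuclideanSpace ℝ (Fin d) →L[ℝ] EuclideanSpace ℝ (Fin d)) :
      EuclideanSpace ℝ (Fin d) →ₗ[ℝ] EuclideanSpace ℝ (Fin d)) = 1)
    (T : ℝ)
    (hT : ∀ u v : EuclideanSpace ℝ (Fin d), ‖u‖ = 1 → ‖v‖ = 1 →
      0 < ‖(D : EuclideanSpace ℝ (Fin d) →L[ℝ] EuclideanSpace ℝ (Fin d)).adjoint u‖ →
      0 < ‖(D : EuclideanSpace ℝ (Fin d) →L[ℝ] EuclideanSpace ℝ (Fin d)).adjoint v‖ →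
      1 + Real.log (‖(D : EuclideanSpace ℝ (Fin d) →L[ℝ] EuclideanSpace ℝ (Fin d)).adjoint u‖ /
        ‖(D : EuclideanSpace ℝ (Fin d) →L[ℝ] EuclideanSpace ℝ (Fin d)).adjoint v‖) ≤ T) :
    ‖(D : EuclideanSpace ℝ (Fin d) →L[ℝ] EuclideanSpace ℝ (Fin d))‖ ≤ Real.exp (T - 1) ∧
    ‖(D.symm : EuclideanSpace ℝ (Fin d) →L[ℝ] EuclideanSpace ℝ (Fin d))‖ ≤ Real.exp (T - 1) := by
  set B : EuclideanSpace ℝ (Fin d) →L[ℝ] EuclideanSpace ℝ (Fin d) :=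
    (D : EuclideanSpace ℝ (Fin d) →L[ℝ] EuclideanSpace ℝ (Fin d)) with hB
  set B' : EuclideanSpace ℝ (Fin d) →L[ℝ] EuclideanSpace ℝ (Fin d) :=
    (D.symm : EuclideanSpace ℝ (Fin d) →L[ℝ] EuclideanSpace ℝ (Fin d)) with hB'
  have hBB : B.comp B' = ContinuousLinearMap.id ℝ _ := by ext1 y; simp [hB, hB']
  have hBB' : B'.comp B = ContinuousLinearMap.id ℝ _ := by ext1 y; simp [hB, hB']
  have hdet' : LinearMap.det (B' : EuclideanSpace ℝ (Fin d) →ₗ[ℝ] EuclideanSpace ℝ (Fin d)) = 1 := by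
    have h1 : (B : EuclideanSpace ℝ (Fin d) →ₗ[ℝ] EuclideanSpace ℝ (Fin d)) ∘ₗ
        (B' : EuclideanSpace ℝ (Fin d) →ₗ[ℝ] EuclideanSpace ℝ (Fin d)) = LinearMap.id := by
      ext1 y; simp [hB, hB']
    have h2 := congrArg LinearMap.det h1
    rw [LinearMap.det_comp, hdet, one_mul, LinearMap.det_id] at h2
    exact h2
  have n1 := aux_det hd B hdet
  have n2 := aux_det hd B' hdet'
  have hadj : ∀ w, B.adjoint (B'.adjoint w) = w := by
    intro w
    have h1 : ∀ y, B' (B y) = y := fun y => DFunLike.congr_fun hBB' y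
    refine ext_inner_right ℝ fun y => ?_
    rw [ContinuousLinearMap.adjoint_inner_left, ContinuousLinearMap.adjoint_inner_left, h1]
  have hadj' : ∀ w, B'.adjoint (B.adjoint w) = w := by
    intro w
    have h1 : ∀ y, B (B' y) = y := fun y => DFunLike.congr_fun hBB y
    refine ext_inner_right ℝ fun y => ?_
    rw [ContinuousLinearMap.adjoint_inner_left, ContinuousLinearMap.adjoint_inner_left, h1]
  have hpos : ∀ w, w ≠ 0 → 0 < ‖B.adjoint w‖ := by
    intro w hw
    rw [norm_pos_iff]
    intro h0
    apply hw
    rw [← hadj' w, h0, map_zero]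
  set Q := Real.exp (T - 1) with hQ
  have hQ0 : 0 < Q := Real.exp_pos _
  have key : ∀ u v : EuclideanSpace ℝ (Fin d), u ≠ 0 → v ≠ 0 →
      ‖B.adjoint u‖ * ‖v‖ ≤ Q * (‖B.adjoint v‖ * ‖u‖) := by
    intro u v hu hv
    have hu' := norm_pos_iff.2 hu
    have hv' := norm_pos_iff.2 hv
    have e1 : ∀ w : EuclideanSpace ℝ (Fin d), ‖B.adjoint (‖w‖⁻¹ • w)‖ = ‖w‖⁻¹ * ‖B.adjoint w‖ := by
      intro w
      rw [map_smul, norm_smul, norm_inv, norm_norm]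
    have pu := hpos u hu
    have pv := hpos v hv
    have h1 := hT (‖u‖⁻¹ • u) (‖v‖⁻¹ • v) 
      (by rw [norm_smul, norm_inv, norm_norm, inv_mul_cancel₀ hu'.ne'])
      (by rw [norm_smul, norm_inv, norm_norm, inv_mul_cancel₀ hv'.ne'])
      (by rw [e1]; positivity) (by rw [e1]; positivity)
    rw [e1, e1] at h1
    have h2 : Real.log (‖u‖⁻¹ * ‖B.adjoint u‖ / (‖v‖⁻¹ * ‖B.adjoint v‖)) ≤ T - 1 := by linarith
    rw [Real.log_le_iff_le_exp (by positivity), ← hQ, div_le_iff₀ (by positivity)] at h2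
    calc ‖B.adjoint u‖ * ‖v‖ = (‖u‖⁻¹ * ‖B.adjoint u‖) * (‖u‖ * ‖v‖) := by field_simp
      _ ≤ (Q * (‖v‖⁻¹ * ‖B.adjoint v‖)) * (‖u‖ * ‖v‖) := by gcongr
      _ = _ := by field_simp
  have key2 : ∀ u w, ‖B.adjoint u‖ * ‖B'.adjoint w‖ ≤ Q * ‖w‖ * ‖u‖ := by
    intro u w
    by_cases hu : u = 0
    · simp [hu]
    by_cases hw : B'.adjoint w = 0
    · rw [hw]; simp only [norm_zero, mul_zero]; positivity
    have := key u _ hu hw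
    rw [hadj] at this
    linarith
  have key3 : ‖B‖ * ‖B'‖ ≤ Q := by
    have hb0 : 0 < ‖B'‖ := by linarith
    have s1 : ∀ w, ‖B‖ * ‖B'.adjoint w‖ ≤ Q * ‖w‖ := by
      intro w
      rcases eq_or_lt_of_le (norm_nonneg (B'.adjoint w)) with h0 | h0
      · rw [← h0]; simp only [mul_zero]; positivity
      rw [← le_div_iff₀ h0, ← LinearIsometryEquiv.norm_map ContinuousLinearMap.adjoint B]
      refine ContinuousLinearMap.opNorm_le_bound _ (by positivity) fun u => ?_
      rw [div_mul_eq_mul_div, le_div_iff₀ h0]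
      exact key2 u w
    have hB0 : 0 < ‖B‖ := by linarith
    rw [mul_comm, ← le_div_iff₀ hB0, ← LinearIsometryEquiv.norm_map ContinuousLinearMap.adjoint B']
    refine ContinuousLinearMap.opNorm_le_bound _ (by positivity) fun w => ?_
    rw [div_mul_eq_mul_div, le_div_iff₀ hB0, mul_comm]
    exact s1 w
  constructor <;> nlinarith

/-- Optimality of the logarithmic growth: let `d ≥ 2` and `φ` a bi-Lipschitz,
measure-preserving, orientation-preserving (a.e. derivative of determinant `1`) homeomorphism
of `ℝ^d`. If composition with `φ` maps every function of `BMO` seminorm `≤ N` to a function of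
`BMO` seminorm `≤ k·N`, then `log K(φ) ≤ C·k` with `C` depending only on `d`. -/
theorem stmt14 (d : ℕ) (hd : 2 ≤ d) :
    ∃ C : ℝ, 0 < C ∧
      ∀ (φ : EuclideanSpace ℝ (Fin d) → EuclideanSpace ℝ (Fin d)),
        Function.Bijective φ →
        (∃ A : NNReal, LipschitzWith A φ) →
        (∃ A : NNReal, LipschitzWith A (Function.invFun φ)) →
        MeasurePreserving φ volume volume →
        -- orientation preserving: an a.e. derivative of determinant 1
        (∃ D : EuclideanSpace ℝ (Fin d) →
            EuclideanSpace ℝ (Fin d) →L[ℝ] EuclideanSpace ℝ (Fin d),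
          ∀ᵐ x ∂(volume : Measure (EuclideanSpace ℝ (Fin d))),
            HasFDerivAt φ (D x) x ∧
            LinearMap.det
              ((D x : EuclideanSpace ℝ (Fin d) →L[ℝ] EuclideanSpace ℝ (Fin d)) :
                EuclideanSpace ℝ (Fin d) →ₗ[ℝ] EuclideanSpace ℝ (Fin d)) = 1) →
        ∀ k : ℝ, 0 < k →
          (∀ (f : EuclideanSpace ℝ (Fin d) → ℝ), LocallyIntegrable f volume →
            ∀ N : ℝ, 0 ≤ N →
              (∀ (x : EuclideanSpace ℝ (Fin d)) (r : ℝ), 0 < r →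
                ⨍ y in ball x r, |f y - ⨍ z in ball x r, f z| ≤ N) →
              (∀ (x : EuclideanSpace ℝ (Fin d)) (r : ℝ), 0 < r →
                ⨍ y in ball x r, |f (φ y) - ⨍ z in ball x r, f (φ z)| ≤ k * N)) →
          Real.log (Kconst φ) ≤ C * k := by
  have hNpos : 0 < 2 * (Real.log (3 * (16 * Real.exp 1)) + 2 * 4^d) := by
    have : 0 ≤ Real.log (3 * (16 * Real.exp 1)) :=
      Real.log_nonneg (by have := Real.add_one_le_exp (1:ℝ); linarith)
    positivity
  refine ⟨4^d * (2 * (Real.log (3 * (16 * Real.exp 1)) + 2 * 4^d)), by positivity, ?_⟩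
  intro φ hbij hLip hLipInv hmp hder k hk0 hk
  obtain ⟨A, hA⟩ := hLip
  obtain ⟨A', hA'⟩ := hLipInv
  obtain ⟨D, hD⟩ := hder
  set C : ℝ := 4^d * (2 * (Real.log (3 * (16 * Real.exp 1)) + 2 * 4^d)) with hC
  set ψ := Function.invFun φ with hψ
  have hφψ : ∀ y, φ (ψ y) = y := Function.rightInverse_invFun hbij.2
  have hψφ : ∀ y, ψ (φ y) = y := Function.leftInverse_invFun hbij.1
  have hd0 : 0 < d := by omega
  set Q := Real.exp (C * k - 1) with hQ
  have hQ0 : 0 < Q := Real.exp_pos _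
  have hT : ∀ x, HasFDerivAt φ (D x) x → ∀ u v : EuclideanSpace ℝ (Fin d), ‖u‖ = 1 → ‖v‖ = 1 →
      0 < ‖(D x).adjoint u‖ → 0 < ‖(D x).adjoint v‖ →
      1 + Real.log (‖(D x).adjoint u‖ / ‖(D x).adjoint v‖) ≤ C * k := by
    intro x hx u v hu hv hu0 hv0
    refine (aux_key φ hA.continuous k hk x (D x) hx u v hu hv hu0 hv0).trans (le_of_eq ?_)
    rw [hC]; ring
  -- derivative and derivative of the inverse
  have hgood : ∀ x, (HasFDerivAt φ (D x) x ∧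
            LinearMap.det
              ((D x : EuclideanSpace ℝ (Fin d) →L[ℝ] EuclideanSpace ℝ (Fin d)) :
                EuclideanSpace ℝ (Fin d) →ₗ[ℝ] EuclideanSpace ℝ (Fin d)) = 1) →
      ∃ e : EuclideanSpace ℝ (Fin d) ≃L[ℝ] EuclideanSpace ℝ (Fin d),
        (e : EuclideanSpace ℝ (Fin d) →L[ℝ] EuclideanSpace ℝ (Fin d)) = D x ∧
        ‖D x‖ ≤ Q ∧ ‖(e.symm : EuclideanSpace ℝ (Fin d) →L[ℝ] EuclideanSpace ℝ (Fin d))‖ ≤ Q ∧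
        1 ≤ C * k := by
    rintro x ⟨hx, hdet⟩
    have hne : (D x).det ≠ 0 := by
      change LinearMap.det _ ≠ 0
      rw [hdet]; exact one_ne_zero
    let e := (D x).toContinuousLinearEquivOfDetNeZero hne
    have he : (e : EuclideanSpace ℝ (Fin d) →L[ℝ] EuclideanSpace ℝ (Fin d)) = D x :=
      ContinuousLinearMap.coe_toContinuousLinearEquivOfDetNeZero _ _
    have h := aux_opnorm hd0 e (by rw [he]; exact hdet) (C * k) (by rw [he]; exact hT x hx)
    have h1 := aux_det hd0 (D x) hdet
    rw [he] at h
    refine ⟨e, he, h.1, h.2, ?_⟩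
    have h2 : 1 ≤ Real.exp (C * k - 1) := h1.trans h.1
    rw [Real.one_le_exp_iff] at h2
    linarith
  have hCk : 1 ≤ C * k := by
    obtain ⟨x, hx⟩ := hD.exists
    obtain ⟨e, -, -, -, h⟩ := hgood x hx
    exact h
  have hup : ∀ x y, dist (φ x) (φ y) ≤ Q * dist x y := by
    intro x y
    have := aux_lip volume φ A hA D Q (hD.mono fun x hx => by
      obtain ⟨e, -, h, -, -⟩ := hgood x hx
      exact ⟨hx.1, h⟩) hQ0.le y (x - y)
    rw [add_sub_cancel] at this
    rwa [dist_eq_norm, dist_eq_norm]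
  have hψmp : MeasurePreserving ψ volume volume := by
    let ε : EuclideanSpace ℝ (Fin d) ≃ᵐ EuclideanSpace ℝ (Fin d) :=
      { toFun := φ, invFun := ψ, left_inv := hψφ, right_inv := hφψ
        measurable_toFun := hA.continuous.measurable
        measurable_invFun := hA'.continuous.measurable }
    exact MeasurePreserving.symm ε hmp
  have hDinv : ∃ D' : EuclideanSpace ℝ (Fin d) →
            EuclideanSpace ℝ (Fin d) →L[ℝ] EuclideanSpace ℝ (Fin d),
      ∀ᵐ y ∂(volume : Measure (EuclideanSpace ℝ (Fin d))), HasFDerivAt ψ (D' y) y ∧ ‖D' y‖ ≤ Q := by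
    refine ⟨fun y => fderiv ℝ ψ y, ?_⟩
    refine (hψmp.quasiMeasurePreserving.ae hD).mono fun y hy => ?_
    obtain ⟨e, he, -, h, -⟩ := hgood _ hy
    have h1 : HasFDerivAt φ (e : EuclideanSpace ℝ (Fin d) →L[ℝ] EuclideanSpace ℝ (Fin d)) (ψ y) := by
      rw [he]; exact hy.1
    have h2 := HasFDerivAt.of_local_left_inverse hA'.continuous.continuousAt h1
      (Filter.Eventually.of_forall hφψ)
    beta_reduce
    rw [h2.fderiv]
    exact ⟨h2, h⟩
  obtain ⟨D', hD'⟩ := hDinv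
  have hdown : ∀ x y, dist x y ≤ Q * dist (φ x) (φ y) := by
    intro x y
    have := aux_lip volume ψ A' hA' D' Q hD' hQ0.le (φ y) (φ x - φ y)
    rw [add_sub_cancel, hψφ, hψφ] at this
    rwa [dist_eq_norm, dist_eq_norm]
  have hK : Kconst φ ≤ 2 * Q := by
    refine Real.iSup_le ?_ (by positivity)
    rintro ⟨⟨x, y⟩, hxy⟩
    have p1 : 0 < dist x y := dist_pos.2 hxy
    have p2 : 0 < dist (φ x) (φ y) := dist_pos.2 (hbij.1.ne hxy)
    have q1 : dist (φ x) (φ y) / dist x y ≤ Q := by rw [div_le_iff₀ p1]; exact hup x y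
    have q2 : dist x y / dist (φ x) (φ y) ≤ Q := by rw [div_le_iff₀ p2]; exact hdown x y
    change dist (φ x) (φ y) / dist x y + dist x y / dist (φ x) (φ y) ≤ 2 * Q
    linarith
  have hK0 : 0 ≤ Kconst φ := Real.iSup_nonneg fun q => by positivity
  rcases eq_or_lt_of_le hK0 with h0 | h0
  · rw [← h0, Real.log_zero]; linarith
  · calc Real.log (Kconst φ) ≤ Real.log (2 * Q) := Real.log_le_log h0 hK
      _ = Real.log 2 + (C * k - 1) := by
        rw [Real.log_mul (by norm_num) hQ0.ne', hQ, Real.log_exp]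
      _ ≤ C * k := by have := Real.log_two_lt_d9; linarith
end
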